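/- Every 2-connected non-bipartite graph has a cycle basis consisting entirely of odd circuits. -/

import Mathlib

open SimpleGraph

variable {V : Type*}

/-- A graph is 2-connected: connected, at least 3 vertices, and deleting any
vertex keeps it connected. -/
def TwoConnected (G : SimpleGraph V) : Prop :=
  G.Connected ∧ 3 ≤ Nat.card V ∧
    ∀ v : V, ((⊤ : G.Subgraph).deleteVerts {v}).coe.Connected

/-- A graph is non-bipartite iff it has an odd circuit. -/
def HasOddCircuit (G : SimpleGraph V) : Prop :=
  ∃ (u : V) (c : G.Walk u u), c.IsCycle ∧ Odd c.length

/-- `G` contains a totally odd subdivision of `C3+` (triangle with a doubled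
edge): equivalently, the union of an odd circuit and an odd path having exactly
its two distinct endpoints on the circuit. -/
def ContainsOddC3Plus (G : SimpleGraph V) : Prop :=
  ∃ (x : V) (c : G.Walk x x) (a b : V) (p : G.Walk a b),
    c.IsCycle ∧ Odd c.length ∧ p.IsPath ∧ Odd p.length ∧ a ≠ b ∧
    a ∈ c.support ∧ b ∈ c.support ∧
    ∀ w ∈ p.support, w ∈ c.support → w = a ∨ w = b

section Space
variable [Fintype V] [DecidableEq V]

/-- `C` is the edge set of a circuit of `G`. -/
def IsCircuitSet (G : SimpleGraph V) (C : Finset (Sym2 V)) : Prop :=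
  ∃ (u : V) (c : G.Walk u u), c.IsCycle ∧ C = c.edges.toFinset

/-- incidence vector over `𝔽₂` of a set of edges -/
def edgeInd (C : Finset (Sym2 V)) : Sym2 V → ZMod 2 :=
  fun e => if e ∈ C then 1 else 0

/-- the cycle space of `G`: the `𝔽₂`-span of incidence vectors of circuits -/
def cycleSpace (G : SimpleGraph V) : Submodule (ZMod 2) (Sym2 V → ZMod 2) :=
  Submodule.span (ZMod 2) {x | ∃ C, IsCircuitSet G C ∧ x = edgeInd C}

/-- `C` is a cycle of `G` (an element of the cycle space). -/
def IsCycleSet (G : SimpleGraph V) (C : Finset (Sym2 V)) : Prop :=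
  edgeInd C ∈ cycleSpace G

/-- `B` is a cycle basis of `G`: a family of cycles whose incidence vectors
form a basis of the cycle space. -/
def IsCycleBasis (G : SimpleGraph V) (B : Finset (Finset (Sym2 V))) : Prop :=
  (∀ C ∈ B, IsCycleSet G C) ∧
  LinearIndependent (ZMod 2) (fun C : B => edgeInd C.1) ∧
  Submodule.span (ZMod 2) (edgeInd '' (B : Set (Finset (Sym2 V)))) = cycleSpace G

end Space

/-- data of a potential ear: two endpoints and a walk between them -/
abbrev EarData (G : SimpleGraph V) := Σ a : V, Σ b : V, G.Walk a b

/-- the union of a base circuit and a list of ears, as a subgraph -/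
def earsUnion {G : SimpleGraph V} {x : V} (base : G.Walk x x)
    (ears : List (EarData G)) : G.Subgraph :=
  ears.foldl (fun H e => H ⊔ e.2.2.toSubgraph) base.toSubgraph

/-- `e` is an ear of the subgraph `H`: a path with exactly its two distinct
endpoints in `H`, all edges new. -/
def IsEar {G : SimpleGraph V} (H : G.Subgraph) (e : EarData G) : Prop :=
  e.2.2.IsPath ∧ e.1 ≠ e.2.1 ∧ e.1 ∈ H.verts ∧ e.2.1 ∈ H.verts ∧
  (∀ v ∈ e.2.2.support, v ≠ e.1 → v ≠ e.2.1 → v ∉ H.verts) ∧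
  ∀ ed ∈ e.2.2.edges, ed ∉ H.edgeSet

/-- an (open) ear-decomposition of `G` -/
structure EarDecomposition (G : SimpleGraph V) where
  x : V
  base : G.Walk x x
  base_cycle : base.IsCycle
  ears : List (EarData G)
  ear_cond : ∀ i (h : i < ears.length),
    IsEar (earsUnion base (ears.take i)) (ears.get ⟨i, h⟩)
  union_top : earsUnion base ears = ⊤

/-- an ear-decomposition is odd if the base circuit and all ears are odd -/
def EarDecomposition.IsOdd {G : SimpleGraph V} (ed : EarDecomposition G) : Prop :=
  Odd ed.base.length ∧ ∀ e ∈ ed.ears, Odd e.2.2.length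

/-- `G` is a totally odd subdivision of `K₄`. -/
def IsTotallyOddK4 (G : SimpleGraph V) : Prop :=
  ∃ (b : Fin 4 → V) (p : ∀ i j : Fin 4, i < j → G.Walk (b i) (b j)),
    Function.Injective b ∧
    (∀ i j h, (p i j h).IsPath ∧ Odd (p i j h).length) ∧
    (∀ i j h i' j' h', (i, j) ≠ (i', j') →
      ∀ v ∈ (p i j h).support, v ∈ (p i' j' h').support →
        (v = b i ∨ v = b j) ∧ (v = b i' ∨ v = b j')) ∧
    (⨆ i, ⨆ j, ⨆ h : i < j, (p i j h).toSubgraph) = ⊤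

/-- `G` contains a totally odd subdivision of `K₄` as a subgraph. -/
def ContainsTotallyOddK4 (G : SimpleGraph V) : Prop :=
  ∃ (b : Fin 4 → V) (p : ∀ i j : Fin 4, i < j → G.Walk (b i) (b j)),
    Function.Injective b ∧
    (∀ i j h, (p i j h).IsPath ∧ Odd (p i j h).length) ∧
    (∀ i j h i' j' h', (i, j) ≠ (i', j') →
      ∀ v ∈ (p i j h).support, v ∈ (p i' j' h').support →
        (v = b i ∨ v = b j) ∧ (v = b i' ∨ v = b j'))

/-- `G` contains an odd theta subgraph through the vertex `w`: three pairwise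
internally disjoint and edge-disjoint odd paths with the same distinct ends,
one of them passing through `w`. -/
def ContainsOddThetaThrough (G : SimpleGraph V) (w : V) : Prop :=
  ∃ (x y : V) (p1 p2 p3 : G.Walk x y), x ≠ y ∧
    p1.IsPath ∧ p2.IsPath ∧ p3.IsPath ∧
    Odd p1.length ∧ Odd p2.length ∧ Odd p3.length ∧
    (∀ v ∈ p1.support, v ∈ p2.support → v = x ∨ v = y) ∧
    (∀ v ∈ p1.support, v ∈ p3.support → v = x ∨ v = y) ∧
    (∀ v ∈ p2.support, v ∈ p3.support → v = x ∨ v = y) ∧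
    (∀ e ∈ p1.edges, e ∉ p2.edges) ∧
    (∀ e ∈ p1.edges, e ∉ p3.edges) ∧
    (∀ e ∈ p2.edges, e ∉ p3.edges) ∧
    (w ∈ p1.support ∨ w ∈ p2.support ∨ w ∈ p3.support)

/-- a graph is factor-critical if deleting any vertex leaves a graph with a
perfect matching -/
def FactorCritical {W : Type*} (H : SimpleGraph W) : Prop :=
  ∀ v : W, ∃ M : ((⊤ : H.Subgraph).deleteVerts {v}).coe.Subgraph,
    M.IsPerfectMatching

namespace SimpleGraph.Walk

variable {V : Type*} {G : SimpleGraph V} {u v w : V}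

theorem IsPath.append_of_inter_eq {p : G.Walk u v} {q : G.Walk v w} (hp : p.IsPath)
    (hq : q.IsPath) (h : ∀ x ∈ p.support, x ∈ q.support → x = v) : (p.append q).IsPath := by
  have hq' := hq.support_nodup
  rw [← q.cons_tail_support, List.nodup_cons] at hq'
  rw [isPath_def, support_append, List.nodup_append']
  refine ⟨hp.support_nodup, hq'.2, fun x hx hxq => ?_⟩
  obtain rfl := h x hx (List.mem_of_mem_tail hxq)
  exact hq'.1 hxq

theorem IsPath.isCycle_append_of_inter {p : G.Walk u v} {q : G.Walk v u} (hp : p.IsPath)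
    (hq : q.IsPath) (h : ∀ x ∈ p.support, x ∈ q.support → x = u ∨ x = v)
    (hn : 3 ≤ p.length + q.length) : (p.append q).IsCycle := by
  have hp' := hp.support_nodup
  have hq' := hq.support_nodup
  rw [← p.cons_tail_support, List.nodup_cons] at hp'
  rw [← q.cons_tail_support, List.nodup_cons] at hq'
  refine hp.isCycle_append hq (fun x hxp hxq => ?_) (by omega)
  rcases h x (List.mem_of_mem_tail hxp) (List.mem_of_mem_tail hxq) with rfl | rfl
  · exact hp'.1 hxp
  · exact hq'.1 hxq

/-- Two distinct vertices of a cycle split it into two internally disjoint paths. -/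
theorem IsCycle.exists_arcs [DecidableEq V] {c : G.Walk w w} (hc : c.IsCycle)
    (hu : u ∈ c.support) (hv : v ∈ c.support) (huv : u ≠ v) :
    ∃ (p : G.Walk u v) (q : G.Walk v u), p.IsPath ∧ q.IsPath ∧
      (∀ x ∈ p.support, x ∈ q.support → x = u ∨ x = v) ∧
      p.support ⊆ c.support ∧ q.support ⊆ c.support ∧ (p.darts ++ q.darts).Perm c.darts := by
  have hd := c.rotate_darts u hu
  have hs : v ∈ (c.rotate u hu).support := (mem_support_rotate_iff c u hu).2 hv
  have hsub : (c.rotate u hu).support ⊆ c.support := fun x => (mem_support_rotate_iff c u hu).1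
  have hr : (c.rotate u hu).IsCycle := hc.rotate hu
  generalize c.rotate u hu = r at hd hs hr hsub
  have hspec := r.take_spec hs
  generalize r.takeUntil v hs = p at hspec
  generalize r.dropUntil v hs = q at hspec
  subst hspec
  refine ⟨p, q, hr.isPath_of_append_left (not_nil_of_ne huv.symm),
    hr.isPath_of_append_right (not_nil_of_ne huv), fun x hxp hxq => ?_,
    fun x hx => hsub ((mem_support_append_iff p q).2 (.inl hx)),
    fun x hx => hsub ((mem_support_append_iff p q).2 (.inr hx)), by simpa using hd.perm⟩
  have hnd := hr.support_nodup
  rw [tail_support_append, List.nodup_append'] at hnd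
  by_contra! hx
  rw [mem_support_iff] at hxp hxq
  exact hnd.2.2 (hxp.resolve_left hx.1) (hxq.resolve_left hx.2)

theorem length_add_length_of_darts_perm {a b a' b' a'' b'' : V} {p : G.Walk a b}
    {q : G.Walk a' b'} {r : G.Walk a'' b''} (h : (p.darts ++ q.darts).Perm r.darts) :
    p.length + q.length = r.length := by
  simpa using h.length_eq

theorem exists_isPath_inter_eq [DecidableEq V] (S : Set V) (p : G.Walk u v) (hv : v ∈ S) :
    ∃ (x : V) (q : G.Walk u x), x ∈ S ∧ q.IsPath ∧ q.support ⊆ p.support ∧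
      ∀ y ∈ q.support, y ∈ S → y = x := by
  have key : ∃ (x : V) (q : G.Walk u x), x ∈ S ∧ q.support ⊆ p.support ∧
      ∀ y ∈ q.support, y ∈ S → y = x := by
    induction p with
    | nil => exact ⟨_, nil, hv, by simp, by simp⟩
    | @cons a b c h p ih =>
      by_cases ha : a ∈ S
      · exact ⟨a, nil, ha, by simp, by simp⟩
      · obtain ⟨x, q, hx, hq, hy⟩ := ih hv
        refine ⟨x, cons h q, hx, ?_, ?_⟩
        · exact List.cons_subset_cons _ hq
        · rintro y hyq hyS
          rw [support_cons, List.mem_cons] at hyq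
          rcases hyq with rfl | hyq
          · exact absurd hyS ha
          · exact hy y hyq hyS
  obtain ⟨x, q, hx, hq, hy⟩ := key
  exact ⟨x, q.bypass, hx, q.bypass_isPath, fun y h => hq (q.support_bypass_subset_support h),
    fun y h => hy y (q.support_bypass_subset_support h)⟩

theorem length_eq_add_of_darts_flip {f : V → ZMod 2} {p : G.Walk u v}
    (h : ∀ d ∈ p.darts, f d.snd = f d.fst + 1) : (p.length : ZMod 2) = f u + f v := by
  induction p with
  | nil => simp [CharTwo.add_self_eq_zero]
  | cons e p ih =>
    simp only [darts_cons, List.forall_mem_cons] at h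
    rw [length_cons, Nat.cast_succ, ih h.2, h.1]
    linear_combination CharTwo.add_self_eq_zero (1 : ZMod 2)

theorem IsPath.exists_darts_flip [DecidableEq V] {p : G.Walk u v} (hp : p.IsPath) :
    ∃ f : V → ZMod 2, f u = 0 ∧ ∀ d ∈ p.darts, f d.snd = f d.fst + 1 := by
  induction p with
  | nil => exact ⟨0, by simp⟩
  | @cons a b c h p ih =>
    rw [cons_isPath_iff] at hp
    obtain ⟨f, hf, hd⟩ := ih hp.1
    refine ⟨Function.update (fun x => f x + 1) a 0, by simp, ?_⟩
    simp only [darts_cons, List.forall_mem_cons]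
    refine ⟨by simp [h.ne', hf], fun d hdp => ?_⟩
    have h1 : d.fst ≠ a := fun h => hp.2 (h ▸ p.dart_fst_mem_support_of_mem_darts hdp)
    have h2 : d.snd ≠ a := fun h => hp.2 (h ▸ p.dart_snd_mem_support_of_mem_darts hdp)
    simp [h1, h2, hd d hdp]

theorem IsCycle.exists_darts_flip [DecidableEq V] {c : G.Walk u u} (hc : c.IsCycle)
    (he : Even c.length) :
    ∃ f : V → ZMod 2, ∀ d ∈ c.darts, f d.snd = f d.fst + 1 := by
  cases c with
  | nil => exact ⟨0, by simp⟩
  | cons h p =>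
    obtain ⟨f, hf, hd⟩ := ((cons_isCycle_iff p h).1 hc).1.exists_darts_flip
    refine ⟨f, ?_⟩
    simp only [darts_cons, List.forall_mem_cons]
    refine ⟨?_, hd⟩
    have hl := length_eq_add_of_darts_flip hd
    have h0 : ((p.length + 1 : ℕ) : ZMod 2) = 0 := (ZMod.natCast_eq_zero_iff_even).2 (by simpa using he)
    rw [Nat.cast_succ, hl, hf, zero_add] at h0
    rw [hf, h0]

/-- A path with ends in `S` that violates the parity prescribed by `f` contains a segment that
violates it and meets `S` only in its ends. -/
theorem IsPath.exists_segment [DecidableEq V] (S : Set V) (f : V → ZMod 2) {p : G.Walk u v}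
    (hp : p.IsPath) (hu : u ∈ S) (hv : v ∈ S) (hf : (p.length : ZMod 2) ≠ f u + f v) :
    ∃ (x y : V) (q : G.Walk x y), x ∈ S ∧ y ∈ S ∧ q.IsPath ∧
      (q.length : ZMod 2) ≠ f x + f y ∧ ∀ z ∈ q.support, z ∈ S → z = x ∨ z = y := by
  induction hn : p.length using Nat.strong_induction_on generalizing u v with
  | _ n ih =>
  by_cases h : ∀ z ∈ p.support, z ∈ S → z = u ∨ z = v
  · exact ⟨u, v, p, hu, hv, hp, hf, h⟩
  push Not at h
  obtain ⟨z, hz, hzS, hzu, hzv⟩ := h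
  by_cases h1 : ((p.takeUntil z hz).length : ZMod 2) = f u + f z
  · refine ih _ (hn ▸ length_dropUntil_lt_length hz hzu) (hp.dropUntil hz) hzS hv (fun h2 => hf ?_) rfl
    have := congrArg length (p.take_spec hz)
    rw [length_append] at this
    rw [← this, Nat.cast_add, h1, h2]
    linear_combination CharTwo.add_self_eq_zero (f z)
  · exact ih _ (hn ▸ length_takeUntil_lt_length hz hzv) (hp.takeUntil hz) hu hzS h1 rfl

/-- The edge vector of a walk over `𝔽₂`, counting multiplicities. -/
def edgeVec [DecidableEq V] (p : G.Walk u v) : Sym2 V → ZMod 2 :=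
  fun e => (p.edges.count e : ZMod 2)

theorem edgeVec_append [DecidableEq V] (p : G.Walk u v) (q : G.Walk v w) :
    (p.append q).edgeVec = p.edgeVec + q.edgeVec := by
  ext e
  simp [edgeVec, edges_append]

theorem edgeVec_reverse [DecidableEq V] (p : G.Walk u v) : p.reverse.edgeVec = p.edgeVec := by
  ext e
  simp [edgeVec]

theorem edgeVec_of_darts_perm [DecidableEq V] {a b a' b' a'' b'' : V} {p : G.Walk a b}
    {q : G.Walk a' b'} {r : G.Walk a'' b''} (h : (p.darts ++ q.darts).Perm r.darts) :
    r.edgeVec = p.edgeVec + q.edgeVec := by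
  ext e
  have := (h.map Dart.edge).count_eq e
  rw [List.map_append, List.count_append] at this
  simp [edgeVec, edges, ← this]

theorem IsTrail.edgeInd_eq [DecidableEq V] {p : G.Walk u v} (hp : p.IsTrail) :
    edgeInd p.edges.toFinset = p.edgeVec := by
  ext e
  by_cases h : e ∈ p.edges
  · simp [edgeInd, edgeVec, h, List.count_eq_one_of_mem hp.edges_nodup h]
  · simp [edgeInd, edgeVec, h, List.count_eq_zero_of_not_mem h]

end SimpleGraph.Walk

open SimpleGraph.Walk

theorem TwoConnected.exists_walk_avoiding {V : Type*} {G : SimpleGraph V} (hG : TwoConnected G)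
    {a b v : V} (ha : a ≠ v) (hb : b ≠ v) : ∃ p : G.Walk a b, v ∉ p.support := by
  have hconn := hG.2.2 v
  have hverts : ∀ x, x ∈ ((⊤ : G.Subgraph).deleteVerts {v}).verts ↔ x ≠ v := by simp
  generalize (⊤ : G.Subgraph).deleteVerts {v} = H at hconn hverts
  obtain ⟨p⟩ := hconn.preconnected ⟨a, (hverts a).2 ha⟩ ⟨b, (hverts b).2 hb⟩
  refine ⟨p.map H.hom, fun h => ?_⟩
  replace h : v ∈ (p.map H.hom).support := h
  rw [Walk.support_map, List.mem_map] at h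
  obtain ⟨x, -, hx⟩ := h
  exact (hverts _).1 x.2 hx

theorem TwoConnected.exists_path_parity {V : Type*} [DecidableEq V] {G : SimpleGraph V}
    (hG : TwoConnected G) {u v w : V} {c : G.Walk w w} (hc : c.IsCycle) (ho : Odd c.length)
    (hu : u ∈ c.support) (huv : u ≠ v) : ∃ p : G.Walk u v, p.IsPath ∧ Even p.length := by
  obtain ⟨x, hx, hxu⟩ : ∃ x ∈ c.support, x ≠ u := by
    by_contra! h
    have h1 := h _ (c.getVert_mem_support 0)
    have h2 := h _ (c.getVert_mem_support 1)
    rw [getVert_zero] at h1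
    have h3 := c.adj_getVert_succ (i := 0) (by have := hc.three_le_length; omega)
    simp only [getVert_zero, zero_add] at h3
    exact h3.ne (h1.trans h2.symm)
  obtain ⟨r, hr⟩ := hG.exists_walk_avoiding huv.symm hxu
  obtain ⟨y, q, hy, hq, hqr, hqy⟩ := r.exists_isPath_inter_eq {z | z ∈ c.support} hx
  have hyu : u ≠ y := fun h => hr (hqr (h ▸ q.end_mem_support))
  obtain ⟨A, B, hA, hB, -, hAc, hBc, hd⟩ := hc.exists_arcs hu hy hyu
  have hl := length_add_length_of_darts_perm hd
  by_cases hpar : Even (A.length + q.length)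
  · exact ⟨A.append q.reverse, hA.append_of_inter_eq hq.reverse
      (fun z hz hz' => hqy z (by simpa using hz') (hAc hz)), by simpa using hpar⟩
  · refine ⟨B.reverse.append q.reverse, hB.reverse.append_of_inter_eq hq.reverse
      (fun z hz hz' => hqy z (by simpa using hz') (hBc (by simpa using hz))), ?_⟩
    rw [length_append, length_reverse, length_reverse]
    grind

theorem TwoConnected.exists_odd_cycle_through {V : Type*} [DecidableEq V] {G : SimpleGraph V}
    (hG : TwoConnected G) (ho : HasOddCircuit G) (v : V) :
    ∃ (w : V) (c : G.Walk w w), c.IsCycle ∧ Odd c.length ∧ v ∈ c.support := by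
  obtain ⟨u, c, hc, hodd⟩ := ho
  obtain ⟨p⟩ := hG.1.preconnected u v
  have hu : ∃ (w : V) (c : G.Walk w w), c.IsCycle ∧ Odd c.length ∧ u ∈ c.support :=
    ⟨u, c, hc, hodd, c.start_mem_support⟩
  clear hc hodd c
  induction p with
  | nil => exact hu
  | @cons a b d h p ih =>
    obtain ⟨w, c, hc, hodd, ha⟩ := hu
    obtain ⟨q, hq, hqe⟩ := hG.exists_path_parity hc hodd ha h.ne
    have hq0 : q.length ≠ 0 := fun h0 => h.ne (eq_of_length_eq_zero h0)
    refine ih ⟨b, (h.symm.toWalk).append q, IsPath.isCycle_append_of_inter (by simp [h.ne']) hq ?_ ?_,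
      ?_, start_mem_support _⟩
    · simp
    · simp only [length_cons, length_nil]
      grind
    · simp only [length_append, length_cons, length_nil]
      grind

section CycleSpace

variable {V : Type*} [DecidableEq V] {G : SimpleGraph V}

/-- The set of incidence vectors of odd circuits. -/
def oddCircuitVectors (G : SimpleGraph V) : Set (Sym2 V → ZMod 2) :=
  {x | ∃ C, (IsCircuitSet G C ∧ Odd C.card) ∧ x = edgeInd C}

theorem edgeInd_injective : Function.Injective (edgeInd (V := V)) := by
  intro C D h
  ext e
  have := congrFun h e
  simp only [edgeInd] at this
  split_ifs at this <;> simp_all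

theorem edgeVec_mem_oddCircuitVectors {u : V} {c : G.Walk u u} (hc : c.IsCycle)
    (ho : Odd c.length) : c.edgeVec ∈ oddCircuitVectors G :=
  ⟨c.edges.toFinset, ⟨⟨u, c, hc, rfl⟩, by
    rwa [List.toFinset_card_of_nodup hc.edges_nodup, length_edges]⟩, hc.isTrail.edgeInd_eq.symm⟩

/-- In a 2-connected non-bipartite graph, every even circuit is the sum of two odd circuits. -/
theorem TwoConnected.edgeVec_mem_span_of_even (hG : TwoConnected G) (ho : HasOddCircuit G) {u : V}
    {c : G.Walk u u} (hc : c.IsCycle) (he : Even c.length) :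
    c.edgeVec ∈ Submodule.span (ZMod 2) (oddCircuitVectors G) := by
  obtain ⟨f, hf⟩ := hc.exists_darts_flip he
  obtain ⟨a, b, hab, hd⟩ : ∃ (a b : V) (h : G.Adj a b), (⟨(a, b), h⟩ : G.Dart) ∈ c.darts := by
    cases c with
    | nil => exact absurd hc not_isCycle_nil
    | cons h p => exact ⟨_, _, h, by simp⟩
  have ha := c.dart_fst_mem_support_of_mem_darts hd
  have hb := c.dart_snd_mem_support_of_mem_darts hd
  obtain ⟨w, D, hD, hDo, haD⟩ := hG.exists_odd_cycle_through ho a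
  obtain ⟨p, hp, hpe⟩ := hG.exists_path_parity hD hDo haD hab.ne
  have hpf : (p.length : ZMod 2) ≠ f a + f b := by
    have h1 : f b = f a + 1 := hf _ hd
    rw [(ZMod.natCast_eq_zero_iff_even).2 hpe, h1, ← add_assoc, CharTwo.add_self_eq_zero]
    decide
  obtain ⟨x, y, q, hx, hy, hq, hqf, hqS⟩ := hp.exists_segment {z | z ∈ c.support} f ha hb hpf
  have hxy : x ≠ y := by
    rintro rfl
    rw [isPath_iff_nil, ← length_eq_zero_iff] at hq
    exact hqf (by simp [hq, CharTwo.add_self_eq_zero])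
  obtain ⟨A, B, hA, hB, -, hAc, hBc, hperm⟩ := hc.exists_arcs hx hy hxy
  have hl := length_add_length_of_darts_perm hperm
  have hAf : (A.length : ZMod 2) = f x + f y :=
    length_eq_add_of_darts_flip fun d hdA => hf d (hperm.subset (List.mem_append_left _ hdA))
  rw [← hAf, Ne, ZMod.natCast_eq_natCast_iff'] at hqf
  have hq0 : q.length ≠ 0 := fun h => hxy (eq_of_length_eq_zero h)
  have hA0 : A.length ≠ 0 := fun h => hxy (eq_of_length_eq_zero h)
  have hB0 : B.length ≠ 0 := fun h => hxy.symm (eq_of_length_eq_zero h)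
  have hAq : Odd (A.length + q.length) := by grind
  have hqB : Odd (q.length + B.length) := by grind
  have h1 : (A.append q.reverse).IsCycle :=
    hA.isCycle_append_of_inter hq.reverse
      (fun z hz hz' => hqS z (by simpa using hz') (hAc hz)) (by rw [length_reverse]; grind)
  have h2 : (q.append B).IsCycle :=
    hq.isCycle_append_of_inter hB (fun z hz hz' => hqS z hz (hBc hz')) (by grind)
  have hsum : c.edgeVec = (A.append q.reverse).edgeVec + (q.append B).edgeVec := by
    rw [edgeVec_append, edgeVec_append, edgeVec_reverse, edgeVec_of_darts_perm hperm]
    ext e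
    simp only [Pi.add_apply]
    linear_combination -(CharTwo.add_self_eq_zero (q.edgeVec e))
  rw [hsum]
  exact add_mem
    (Submodule.subset_span (edgeVec_mem_oddCircuitVectors h1 (by simpa using hAq)))
    (Submodule.subset_span (edgeVec_mem_oddCircuitVectors h2 (by simpa using hqB)))

theorem TwoConnected.span_oddCircuitVectors (hG : TwoConnected G) (ho : HasOddCircuit G) :
    Submodule.span (ZMod 2) (oddCircuitVectors G) = cycleSpace G := by
  apply le_antisymm
  · refine Submodule.span_mono ?_
    rintro x ⟨C, ⟨hC, -⟩, rfl⟩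
    exact ⟨C, hC, rfl⟩
  · refine Submodule.span_le.2 ?_
    rintro x ⟨C, ⟨u, c, hc, rfl⟩, rfl⟩
    rw [hc.isTrail.edgeInd_eq]
    rcases Nat.even_or_odd c.length with h | h
    · exact hG.edgeVec_mem_span_of_even ho hc h
    · exact Submodule.subset_span (edgeVec_mem_oddCircuitVectors hc h)

end CycleSpace

/-- every 2-connected non-bipartite graph has a cycle basis
consisting entirely of odd circuits. -/
theorem stmt1 {V : Type*} [Fintype V] [DecidableEq V]
    (G : SimpleGraph V) (hG : TwoConnected G) (hnb : HasOddCircuit G) :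
    ∃ B : Finset (Finset (Sym2 V)), IsCycleBasis G B ∧
      ∀ C ∈ B, IsCircuitSet G C ∧ Odd C.card := by
  classical
  obtain ⟨b, hbs, hspan, hli⟩ := exists_linearIndependent (ZMod 2) (oddCircuitVectors G)
  have hodd : ∀ C, edgeInd C ∈ b → IsCircuitSet G C ∧ Odd C.card := by
    intro C hC
    obtain ⟨D, hD, hCD⟩ := hbs hC
    rwa [edgeInd_injective hCD]
  obtain ⟨B, hB⟩ : ∃ B : Finset (Finset (Sym2 V)), ∀ C, C ∈ B ↔ edgeInd C ∈ b :=
    ⟨Finset.univ.filter fun C => edgeInd C ∈ b, fun C => by simp⟩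
  refine ⟨B, ⟨fun C hC => ?_, ?_, ?_⟩, fun C hC => hodd C ((hB C).1 hC)⟩
  · exact Submodule.subset_span ⟨C, (hodd C ((hB C).1 hC)).1, rfl⟩
  · have hinj : Function.Injective fun C : B => (⟨edgeInd C.1, (hB C).1 C.2⟩ : b) :=
      fun C D h => Subtype.ext (edgeInd_injective (congrArg Subtype.val h))
    have h1 : LinearIndependent (ZMod 2) ((↑) : b → (Sym2 V → ZMod 2)) := hli
    have h2 := h1.comp _ hinj
    exact h2
  · rw [← hG.span_oddCircuitVectors hnb, ← hspan]
    congr 1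
    ext x
    constructor
    · rintro ⟨C, hC, rfl⟩
      exact (hB C).1 hC
    · intro hx
      obtain ⟨C, -, rfl⟩ := hbs hx
      exact ⟨C, (hB C).2 hx, rfl⟩
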